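/- (Neo-classical inequality) For $\alpha \in (0,1]$, $n \in \mathbb{N}$ and $s, t > 0$, $\alpha \sum_{j=0}^{n} \frac{s^{j\alpha} t^{(n-j)\alpha}}{\Gamma(1+j\alpha)\Gamma(1+(n-j)\alpha)} \leq \frac{(s+t)^{n\alpha}}{\Gamma(1+n\alpha)}$. -/

import Mathlib

open PowerSeries Finset Filter Topology

noncomputable section

namespace NeoClassical

section General

variable {R : Type*} [CommRing R]

/-- The derivation of `R⟦X⟧` that applies a derivation of `R` to every coefficient. -/
def coeffwise {k : Type*} [CommRing k] [Algebra k R] (D : Derivation k R R) :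
    Derivation k R⟦X⟧ R⟦X⟧ :=
  Derivation.mk'
    { toFun := fun f => PowerSeries.mk fun n => D (coeff n f)
      map_add' := fun f g => by ext n; simp
      map_smul' := fun c f => by ext n; simp }
    (fun f g => by
      ext n
      simp only [LinearMap.coe_mk, AddHom.coe_mk, smul_eq_mul, map_add, coeff_mul, coeff_mk,
        map_sum, Derivation.leibniz, sum_add_distrib]
      congr 1
      rw [← Finset.Nat.sum_antidiagonal_swap]
      rfl)

@[simp]
theorem coeff_coeffwise {k : Type*} [CommRing k] [Algebra k R] (D : Derivation k R R)
    (f : R⟦X⟧) (n : ℕ) : coeff n (coeffwise D f) = D (coeff n f) := by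
  simp [coeffwise]

/-- The formal derivative, as a derivation over `ℝ`. -/
def realDerivative (R : Type*) [CommRing R] [Algebra ℝ R] : Derivation ℝ R⟦X⟧ R⟦X⟧ :=
  (derivative R).restrictScalars ℝ

theorem realDerivative_apply [Algebra ℝ R] (f : R⟦X⟧) :
    realDerivative R f = derivative R f := rfl

theorem coeff_realDerivative [Algebra ℝ R] (f : R⟦X⟧) (n : ℕ) :
    coeff n (realDerivative R f) = coeff (n + 1) f * (n + 1) :=
  coeff_derivative f n

/-- A one-variable series, seen as a series in the outer variable of `R⟦X⟧⟦X⟧`. -/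
def outer : R⟦X⟧ →+* R⟦X⟧⟦X⟧ := PowerSeries.map (C : R →+* R⟦X⟧)

/-- A one-variable series, seen as a series in the inner variable of `R⟦X⟧⟦X⟧`. -/
def inner : R⟦X⟧ →+* R⟦X⟧⟦X⟧ := C

theorem coeff_outer (f : R⟦X⟧) (k : ℕ) : coeff k (outer f) = C (coeff k f) := rfl

theorem outer_X : outer (X : R⟦X⟧) = X := by simp [outer]

theorem outer_C (r : R) : outer (C r) = inner (C r) := by simp [outer, inner]

theorem coeff_inner_mul (f : R⟦X⟧) (F : R⟦X⟧⟦X⟧) (k : ℕ) :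
    coeff k (inner f * F) = f * coeff k F := by simp [inner]

theorem coeff_outer_mul_inner (f g : R⟦X⟧) (k l : ℕ) :
    coeff l (coeff k (outer f * inner g)) = coeff k f * coeff l g := by
  rw [mul_comm, coeff_inner_mul, coeff_outer, mul_comm, coeff_C_mul]

theorem coeff_coeff_outer_mul (f : R⟦X⟧) (F : R⟦X⟧⟦X⟧) (k l : ℕ) :
    coeff l (coeff k (outer f * F)) =
      ∑ p ∈ antidiagonal k, coeff p.1 f * coeff l (coeff p.2 F) := by
  simp [coeff_mul k, coeff_outer]

/-- The difference of the two variables. -/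
def varDiff : R⟦X⟧⟦X⟧ := outer X - inner X

theorem coeff_varDiff_mul (F : R⟦X⟧⟦X⟧) (k l : ℕ) :
    coeff l (coeff k (varDiff * F)) =
      (if k = 0 then 0 else coeff l (coeff (k - 1) F)) -
        (if l = 0 then 0 else coeff (l - 1) (coeff k F)) := by
  rw [varDiff, sub_mul, map_sub, map_sub, coeff_inner_mul, outer_X]
  cases k <;> cases l <;> simp [coeff_succ_X_mul]

theorem varDiff_ne_zero [Nontrivial R] : (varDiff : R⟦X⟧⟦X⟧) ≠ 0 := by
  intro h
  have := congrArg (fun F => coeff 0 (coeff 1 F)) h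
  simp [varDiff, outer_X, inner] at this

/-- The divided difference `(f(x) - f(y)) / (x - y)`. -/
def divDiff (f : R⟦X⟧) : R⟦X⟧⟦X⟧ :=
  PowerSeries.mk fun k => PowerSeries.mk fun l => coeff (k + l + 1) f

/-- The second divided difference `f[x, y, y]`. -/
def divDiffTwo (f : R⟦X⟧) : R⟦X⟧⟦X⟧ :=
  PowerSeries.mk fun k => PowerSeries.mk fun l => (l + 1) * coeff (k + l + 2) f

theorem varDiff_mul_divDiff (f : R⟦X⟧) : varDiff * divDiff f = outer f - inner f := by
  ext k l
  rw [coeff_varDiff_mul]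
  rcases k with _ | k <;> rcases l with _ | l <;>
    simp [divDiff, inner, coeff_outer, coeff_C, -coeff_zero_eq_constantCoeff]
  rw [sub_eq_zero]
  congr 2
  ring

theorem varDiff_mul_divDiffTwo (f : R⟦X⟧) :
    varDiff * divDiffTwo f = divDiff f - inner (derivative R f) := by
  ext k l
  rw [coeff_varDiff_mul]
  rcases k with _ | k <;> rcases l with _ | l <;>
    simp [divDiff, divDiffTwo, inner, coeff_C, coeff_derivative, -coeff_zero_eq_constantCoeff]
  · ring
  · rw [show k + (l + 1) + 2 = k + 1 + l + 2 by ring,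
      show k + 1 + (l + 1) + 1 = k + 1 + l + 2 by ring]
    ring

theorem C_series_ne_zero {r : R} (hr : r ≠ 0) : (C r : R⟦X⟧) ≠ 0 :=
  fun h => hr (PowerSeries.C_injective (h.trans (map_zero C).symm))

theorem one_sub_X_ne_zero [Nontrivial R] : (1 - X : R⟦X⟧) ≠ 0 := by
  intro h
  have := congrArg (coeff 0) h
  simp at this

end General

section Binomial

variable {R : Type*} [CommRing R] [Algebra ℝ R]

theorem eq_zero_of_ode {r : R} {f : R⟦X⟧} (h : (1 - X) * derivative R f = C r * f)
    (h0 : coeff 0 f = 0) : f = 0 := by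
  ext n
  induction n with
  | zero => simpa using h0
  | succ n ih =>
    have hn := congrArg (coeff n) h
    have key : coeff (n + 1) f * ((n : R) + 1) = 0 := by
      rw [sub_mul, one_mul, map_sub, coeff_C_mul, ih, coeff_derivative] at hn
      cases n with
      | zero => simpa using hn
      | succ n =>
        rw [coeff_succ_X_mul, coeff_derivative, ih] at hn
        simpa using hn
    have hu : IsUnit ((n : R) + 1) := by
      have := (IsUnit.mk0 ((n : ℝ) + 1) (by positivity)).map (algebraMap ℝ R)
      simpa using this
    simpa using (hu.mul_left_eq_zero).1 key

/-- The binomial series `(1 - X) ^ (-r)`. -/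
def negBinomial (r : R) : R⟦X⟧ :=
  PowerSeries.mk fun m => ∏ i ∈ range m, ((i : ℝ) + 1)⁻¹ • (r + i)

theorem coeff_zero_negBinomial (r : R) : coeff 0 (negBinomial r) = 1 := by simp [negBinomial]

theorem negBinomial_ode (r : R) :
    (1 - X) * derivative R (negBinomial r) = C r * negBinomial r := by
  have hs : ∀ n, coeff (n + 1) (negBinomial r) * ((n : R) + 1) =
      (r + n) * coeff n (negBinomial r) := by
    intro n
    simp only [negBinomial, coeff_mk, prod_range_succ]
    have : ((n : ℝ) + 1)⁻¹ • (r + n) * ((n : R) + 1) = r + n := by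
      have h1 : ((n : R) + 1) = algebraMap ℝ R ((n : ℝ) + 1) := by simp
      rw [h1, mul_comm, ← Algebra.smul_def, smul_smul, mul_inv_cancel₀ (by positivity), one_smul]
    rw [mul_assoc, this, mul_comm]
  ext n
  rw [sub_mul, one_mul, map_sub, coeff_C_mul, coeff_derivative, hs]
  cases n with
  | zero => simp
  | succ n =>
    rw [coeff_succ_X_mul, coeff_derivative]
    push_cast
    ring

theorem eq_negBinomial {r : R} {f : R⟦X⟧} (h : (1 - X) * derivative R f = C r * f)
    (h0 : coeff 0 f = 1) : f = negBinomial r := by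
  rw [← sub_eq_zero]
  apply eq_zero_of_ode (r := r)
  · rw [map_sub, mul_sub, mul_sub, h, negBinomial_ode]
  · rw [map_sub, h0, coeff_zero_negBinomial, sub_self]

theorem negBinomial_add (r s : R) : negBinomial (r + s) = negBinomial r * negBinomial s := by
  symm
  apply eq_negBinomial
  · rw [Derivation.leibniz, smul_eq_mul, smul_eq_mul, map_add]
    linear_combination negBinomial s * negBinomial_ode r + negBinomial r * negBinomial_ode s
  · simp only [coeff_zero_eq_constantCoeff, map_mul]
    have := coeff_zero_negBinomial r
    have := coeff_zero_negBinomial s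
    simp_all

theorem negBinomial_zero : negBinomial (0 : R) = 1 := by
  symm; apply eq_negBinomial <;> simp

theorem negBinomial_neg_one : negBinomial (-1 : R) = 1 - X := by
  symm; apply eq_negBinomial <;> simp

theorem negBinomial_nat_mul (n : ℕ) (r : R) : negBinomial (n * r) = negBinomial r ^ n := by
  induction n with
  | zero => simp [negBinomial_zero]
  | succ n ih => rw [pow_succ, ← ih, ← negBinomial_add]; congr 1; push_cast; ring

/-- The series of `-log (1 - X)`. -/
def negLog : R⟦X⟧ := PowerSeries.mk fun m => algebraMap ℝ R (m : ℝ)⁻¹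

/-- The series of `X + (1 - X) * log (1 - X)`. -/
def entropy : R⟦X⟧ := PowerSeries.mk fun m => algebraMap ℝ R ((m : ℝ) * (m - 1))⁻¹

theorem derivative_entropy : derivative R (entropy : R⟦X⟧) = negLog := by
  ext n
  have : ((n : R) + 1) = algebraMap ℝ R ((n : ℝ) + 1) := by simp
  rw [coeff_derivative, entropy, negLog, coeff_mk, coeff_mk, this, ← map_mul]
  congr 1
  push_cast
  rw [add_sub_cancel_right, mul_inv, mul_right_comm, inv_mul_cancel₀ (by positivity), one_mul]

theorem one_sub_X_mul_derivative_negLog : (1 - X) * derivative R (negLog : R⟦X⟧) = 1 := by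
  have : derivative R (negLog : R⟦X⟧) = PowerSeries.mk fun _ => 1 := by
    ext n
    have : ((n : R) + 1) = algebraMap ℝ R ((n : ℝ) + 1) := by simp
    rw [coeff_derivative, negLog, coeff_mk, coeff_mk, this, ← map_mul]
    rw [← Nat.cast_add_one, inv_mul_cancel₀ (by positivity), map_one]
  rw [this, mul_comm]
  exact PowerSeries.mk_one_mul_one_sub_eq_one R

theorem entropy_eq : (entropy : R⟦X⟧) = X - (1 - X) * negLog := by
  ext n
  rcases n with _ | _ | n
  · simp [entropy, negLog]
  · simp [entropy, negLog, sub_mul, coeff_succ_X_mul]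
  · rw [sub_mul, one_mul, map_sub, map_sub, coeff_succ_X_mul, coeff_X, if_neg (by omega), entropy,
      negLog, coeff_mk, coeff_mk, coeff_mk, ← map_sub, zero_sub, ← map_neg]
    congr 1
    push_cast
    rw [add_sub_cancel_right]
    have : ((n : ℝ) + 1) ≠ 0 := by positivity
    have : ((n : ℝ) + 1 + 1) ≠ 0 := by positivity
    field_simp
    ring

end Binomial

section Slope

variable {R : Type*} [CommRing R] [Algebra ℝ R]

/-- The series of `(1 - (1 - X) ^ r) / r`. -/
def slope (r : R) : R⟦X⟧ :=
  X * PowerSeries.mk fun m => ∏ i ∈ range m, ((i : ℝ) + 2)⁻¹ • (i + 1 - r)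

theorem negBinomial_neg_eq (r : R) : negBinomial (-r) = 1 - C r * slope r := by
  ext n
  cases n with
  | zero => simp [negBinomial, slope]
  | succ n =>
    rw [map_sub, coeff_C_mul, slope, coeff_succ_X_mul, negBinomial, coeff_mk, coeff_mk,
      prod_range_succ']
    simp only [coeff_one, Nat.succ_ne_zero, if_false]
    have : ∀ i : ℕ, (((i + 1 : ℕ) : ℝ) + 1)⁻¹ • (-r + ((i + 1 : ℕ) : R)) =
        ((i : ℝ) + 2)⁻¹ • (i + 1 - r) := by
      intro i
      push_cast
      congr 1
      · ring
      · ring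
    simp only [this]
    simp
    ring

theorem isUnit_divDiff_slope (r : R) : IsUnit (divDiff (slope r)) := by
  rw [PowerSeries.isUnit_iff_constantCoeff, PowerSeries.isUnit_iff_constantCoeff]
  have : constantCoeff (constantCoeff (divDiff (slope r))) = 1 := by
    rw [← coeff_zero_eq_constantCoeff_apply, ← coeff_zero_eq_constantCoeff_apply, divDiff,
      coeff_mk, coeff_mk, slope, zero_add, coeff_succ_X_mul]
    simp
  rw [this]
  exact isUnit_one

theorem one_sub_X_mul_derivative_slope [IsDomain R] {r : R} (hr : r ≠ 0) :
    (1 - X) * derivative R (slope r) = negBinomial (-r) := by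
  have h := negBinomial_ode (-r)
  have hC : (C r : R⟦X⟧) ≠ 0 := C_series_ne_zero hr
  apply mul_left_cancel₀ hC
  nth_rewrite 1 [negBinomial_neg_eq] at h
  rw [map_sub, Derivation.leibniz, derivative_C, derivative_one, map_neg] at h
  simp only [smul_eq_mul, mul_zero, add_zero] at h
  linear_combination -h

end Slope

section Kernel

variable {R : Type*} [CommRing R] [Algebra ℝ R]

/-- The derivation `D + (1 - x) log (1 - x) ∂_x`. -/
def flow (D : Derivation ℝ R R) : Derivation ℝ R⟦X⟧ R⟦X⟧ :=
  coeffwise D + (entropy - X : R⟦X⟧) • realDerivative R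

/-- The derivation `D + (1 - x) log (1 - x) ∂_x + (1 - y) log (1 - y) ∂_y`. -/
def flowTwo (D : Derivation ℝ R R) : Derivation ℝ R⟦X⟧⟦X⟧ R⟦X⟧⟦X⟧ :=
  coeffwise (coeffwise D) + outer (entropy - X : R⟦X⟧) • realDerivative R⟦X⟧ +
    inner (entropy - X : R⟦X⟧) • coeffwise (realDerivative R)

variable (D : Derivation ℝ R R)

theorem flow_apply (f : R⟦X⟧) :
    flow D f = coeffwise D f + (entropy - X) * derivative R f := rfl

theorem flowTwo_apply (F : R⟦X⟧⟦X⟧) : flowTwo D F =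
    coeffwise (coeffwise D) F + outer (entropy - X) * realDerivative R⟦X⟧ F +
      inner (entropy - X) * coeffwise (realDerivative R) F := rfl

theorem coeff_flowTwo (F : R⟦X⟧⟦X⟧) (k l : ℕ) :
    coeff l (coeff k (flowTwo D F)) = D (coeff l (coeff k F)) - (k + l) * coeff l (coeff k F) +
      ∑ p ∈ antidiagonal k, coeff p.1 entropy * (coeff l (coeff (p.2 + 1) F) * (p.2 + 1)) +
      ∑ p ∈ antidiagonal l, coeff p.1 entropy * (coeff (p.2 + 1) (coeff k F) * (p.2 + 1)) := by
  have hd : ∀ i, coeff l (coeff i (realDerivative R⟦X⟧ F)) =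
      coeff l (coeff (i + 1) F) * (i + 1) := by
    intro i
    rw [coeff_realDerivative, ← Nat.cast_add_one, mul_comm (coeff (i + 1) F),
      ← map_natCast (C (R := R)), coeff_C_mul, mul_comm, Nat.cast_add_one]
  have hX1 : coeff l (coeff k (outer X * realDerivative R⟦X⟧ F)) = k * coeff l (coeff k F) := by
    rw [outer_X]
    cases k with
    | zero => simp
    | succ k =>
      rw [coeff_succ_X_mul, hd]
      push_cast
      ring
  have hX2 : coeff l (X * coeff k (coeffwise (realDerivative R) F)) = l * coeff l (coeff k F) := by
    rw [coeff_coeffwise]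
    cases l with
    | zero => simp
    | succ l =>
      rw [coeff_succ_X_mul, coeff_realDerivative]
      push_cast
      ring
  have hE : coeff l (entropy * coeff k (coeffwise (realDerivative R) F)) =
      ∑ p ∈ antidiagonal l, coeff p.1 entropy * (coeff (p.2 + 1) (coeff k F) * (p.2 + 1)) := by
    simp only [coeff_mul, coeff_coeffwise, coeff_realDerivative]
  rw [flowTwo_apply, map_sub, map_sub, sub_mul, sub_mul]
  simp only [map_add, map_sub, hX1, coeff_inner_mul, hX2, hE, coeff_coeff_outer_mul, hd]
  simp only [coeff_coeffwise]
  ring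

theorem flowTwo_inner (f : R⟦X⟧) : flowTwo D (inner f) = inner (flow D f) := by
  have hc : ∀ E : Derivation ℝ R⟦X⟧ R⟦X⟧, coeffwise E (inner f) = inner (E f) := by
    intro E
    ext k : 1
    rw [coeff_coeffwise]
    simp only [inner, coeff_C]
    split_ifs <;> simp
  have h : realDerivative R⟦X⟧ (inner f) = 0 := by
    ext k : 1
    simp [coeff_realDerivative, inner]
  rw [flowTwo_apply, hc, hc, h, flow_apply, map_add, map_mul, realDerivative_apply]
  ring

theorem flowTwo_outer (f : R⟦X⟧) : flowTwo D (outer f) = outer (flow D f) := by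
  have h1 : coeffwise (coeffwise D) (outer f) = outer (coeffwise D f) := by
    ext k l : 2
    simp only [coeff_coeffwise, coeff_outer, coeff_C]
    split_ifs <;> simp
  have h2 : coeffwise (realDerivative R) (outer f) = 0 := by
    ext k l : 2
    rw [coeff_coeffwise, coeff_outer, coeff_realDerivative, coeff_C]
    simp
  have h3 : realDerivative R⟦X⟧ (outer f) = outer (derivative R f) := by
    ext k : 1
    simp only [coeff_realDerivative, coeff_derivative, coeff_outer]
    simp
  rw [flowTwo_apply, h1, h2, h3, flow_apply, map_add, map_mul]
  ring

theorem coeffwise_X : coeffwise D (X : R⟦X⟧) = 0 := by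
  ext n : 1
  simp only [coeff_coeffwise, coeff_X]
  split_ifs <;> simp

theorem coeffwise_C (r : R) : coeffwise D (C r) = C (D r) := by
  ext n : 1
  simp only [coeff_coeffwise, coeff_C]
  split_ifs <;> simp

theorem coeffwise_derivative (f : R⟦X⟧) :
    coeffwise D (derivative R f) = derivative R (coeffwise D f) := by
  ext n : 1
  simp only [coeff_coeffwise, coeff_derivative, Derivation.leibniz]
  have : D ((n : R) + 1) = 0 := by simp
  simp [this, mul_comm]

variable {D} {a : R}

theorem coeffwise_negBinomial (hD : D a = a) :
    coeffwise D (negBinomial (-a)) = -(C a * negLog * negBinomial (-a)) := by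
  have ode := negBinomial_ode (-a)
  have hode := congrArg (coeffwise D) ode
  rw [Derivation.leibniz, Derivation.leibniz, coeffwise_C, map_sub, coeffwise_X,
    coeffwise_derivative, Derivation.map_one_eq_zero, map_neg D, hD] at hode
  simp only [smul_eq_mul, map_neg] at hode ode
  rw [eq_neg_iff_add_eq_zero]
  apply eq_zero_of_ode (r := -a)
  · rw [map_add, Derivation.leibniz, Derivation.leibniz, derivative_C]
    simp only [smul_eq_mul, map_neg]
    linear_combination hode + C a * negLog * ode +
      C a * negBinomial (-a) * one_sub_X_mul_derivative_negLog (R := R)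
  · rw [map_add, coeff_coeffwise, coeff_zero_negBinomial]
    simp [negLog]

theorem flow_negBinomial (hD : D a = a) : flow D (negBinomial (-a)) = 0 := by
  rw [flow_apply, coeffwise_negBinomial hD, entropy_eq]
  have h := negBinomial_ode (-a)
  rw [map_neg] at h
  linear_combination (-negLog) * h

theorem flow_X : flow D (X : R⟦X⟧) = entropy - X := by
  rw [flow_apply, coeffwise_X, derivative_X]
  ring

theorem flow_C (hD : D a = a) : flow D (C a : R⟦X⟧) = C a := by
  rw [flow_apply, coeffwise_C, derivative_C, hD]
  ring

/-- The kernel `1 / (q - p) - a q ^ (a - 1) / (q ^ a - p ^ a)`, where `p = 1 - x` and `q = 1 - y`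
for the outer variable `x` and the inner variable `y`. -/
def kernel (a : R) : R⟦X⟧⟦X⟧ := divDiffTwo (slope a) * ↑(isUnit_divDiff_slope a).unit⁻¹

theorem varDiff_mul_kernel_mul (a : R) : varDiff * kernel a * divDiff (slope a) =
    divDiff (slope a) - inner (derivative R (slope a)) := by
  rw [← varDiff_mul_divDiffTwo, kernel, mul_assoc, mul_assoc, IsUnit.val_inv_mul, mul_one]

variable [IsDomain R]

theorem flow_slope (hD : D a = a) (h0 : a ≠ 0) : flow D (slope a) = -slope a := by
  have h := congrArg (flow D) (negBinomial_neg_eq a)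
  rw [flow_negBinomial hD, map_sub, Derivation.leibniz, flow_C hD, Derivation.map_one_eq_zero] at h
  simp only [smul_eq_mul] at h
  apply mul_left_cancel₀ (C_series_ne_zero h0)
  linear_combination h

theorem flow_derivative_slope (hD : D a = a) (h0 : a ≠ 0) :
    flow D (derivative R (slope a)) = -negLog * derivative R (slope a) := by
  have h := congrArg (flow D) (one_sub_X_mul_derivative_slope h0)
  rw [flow_negBinomial hD, Derivation.leibniz, map_sub, flow_X, Derivation.map_one_eq_zero,
    entropy_eq] at h
  simp only [smul_eq_mul] at h
  apply mul_left_cancel₀ one_sub_X_ne_zero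
  linear_combination h

theorem flowTwo_kernel (hD : D a = a) (h0 : a ≠ 0) :
    flowTwo D (kernel a) = (1 - inner negLog) * kernel a - divDiffTwo entropy := by
  set U := divDiff (slope a)
  set Δ : R⟦X⟧⟦X⟧ := varDiff with hΔ
  have hU : U ≠ 0 := (isUnit_divDiff_slope a).ne_zero
  have h1 : Δ * U = outer (slope a) - inner (slope a) := varDiff_mul_divDiff _
  have hδΔ : flowTwo D Δ = outer (entropy - X) - inner (entropy - X) := by
    rw [hΔ, varDiff, map_sub, flowTwo_outer, flowTwo_inner, flow_X]
  have hδU : Δ * flowTwo D U = -(flowTwo D Δ + Δ) * U := by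
    have h2 := congrArg (flowTwo D) h1
    rw [Derivation.leibniz, map_sub, flowTwo_outer, flowTwo_inner, flow_slope hD h0, map_neg,
      map_neg, smul_eq_mul, smul_eq_mul] at h2
    linear_combination h2 + h1
  have hK : Δ * kernel a * U = U - inner (derivative R (slope a)) := varDiff_mul_kernel_mul a
  have hδK := congrArg (flowTwo D) hK
  rw [Derivation.leibniz, Derivation.leibniz, map_sub, flowTwo_inner, flow_derivative_slope hD h0,
    map_mul, map_neg] at hδK
  simp only [smul_eq_mul] at hδK
  have hc : Δ * Δ * divDiffTwo entropy = outer entropy - inner entropy - Δ * inner negLog := by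
    rw [mul_assoc, hΔ, varDiff_mul_divDiffTwo, derivative_entropy, mul_sub, varDiff_mul_divDiff]
  have hΔX : Δ = outer X - inner X := rfl
  rw [map_sub, map_sub] at hδΔ
  apply mul_left_cancel₀ (mul_ne_zero (mul_ne_zero varDiff_ne_zero varDiff_ne_zero) hU)
  rw [← hΔ]
  linear_combination Δ * hδK + Δ * inner negLog * hK + (1 - Δ * kernel a) * hδU + U * hc -
    U * hδΔ - U * hΔX

theorem kernel_identity (h0 : a ≠ 0) :
    inner (1 - X) * varDiff * (inner (negBinomial (-a)) - outer (negBinomial (-a))) * kernel a =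
      inner (1 - X) * (inner (negBinomial (-a)) - outer (negBinomial (-a))) -
        inner (C a) * varDiff * inner (negBinomial (-a)) := by
  have h1 : varDiff * divDiff (slope a) = _ := varDiff_mul_divDiff _
  have h2 := varDiff_mul_kernel_mul a
  have h3 := congrArg inner (one_sub_X_mul_derivative_slope h0)
  have h4 := congrArg inner (negBinomial_neg_eq a)
  have h5 := congrArg outer (negBinomial_neg_eq a)
  rw [map_sub, map_mul, map_one] at h4 h5
  rw [outer_C] at h5
  rw [map_mul] at h3
  linear_combination (inner (1 - X) * varDiff * kernel a - inner (1 - X)) * (h4 - h5) +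
    (inner (C a) * inner (1 - X) - inner (1 - X) * varDiff * kernel a * inner (C a)) * h1 +
    inner (1 - X) * inner (C a) * varDiff * h2 - inner (C a) * varDiff * h3

end Kernel

section Positivity

open Polynomial (derivative' eval)

theorem eval_nonneg_of_euler {p q : Polynomial ℝ} {N : ℕ}
    (h : Polynomial.X * Polynomial.derivative p = (N : Polynomial ℝ) * p - q)
    (hq : ∀ t : ℝ, 0 < t → t ≤ 1 → 0 ≤ q.eval t) (h1 : p.eval 1 = 0)
    (t : ℝ) (ht0 : 0 < t) (ht1 : t ≤ 1) : 0 ≤ p.eval t := by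
  have hd : ∀ u : ℝ, 0 < u → HasDerivAt (fun u => p.eval u / u ^ N)
      (-(q.eval u) / u ^ (N + 1)) u := by
    intro u hu
    have hp := (p.hasDerivAt u).div (hasDerivAt_pow N u) (pow_ne_zero N hu.ne')
    have hu' := congrArg (Polynomial.eval u) h
    simp only [Polynomial.eval_mul, Polynomial.eval_X, Polynomial.eval_sub,
      Polynomial.eval_natCast] at hu'
    have hq' : q.eval u = N * p.eval u - u * (Polynomial.derivative p).eval u := by linarith
    have he : -(q.eval u) / u ^ (N + 1) = ((Polynomial.derivative p).eval u * u ^ N -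
        p.eval u * (N * u ^ (N - 1))) / (u ^ N) ^ 2 := by
      rw [hq']
      cases N with
      | zero => field_simp; simp
      | succ N =>
        rw [Nat.add_sub_cancel]
        field_simp
        ring
    rw [he]
    exact hp
  have hanti : AntitoneOn (fun u => p.eval u / u ^ N) (Set.Icc t 1) := by
    apply antitoneOn_of_deriv_nonpos (convex_Icc t 1)
    · exact fun u hu => (hd u (ht0.trans_le hu.1)).continuousAt.continuousWithinAt
    · rw [interior_Icc]
      exact fun u hu => (hd u (ht0.trans hu.1)).differentiableAt.differentiableWithinAt
    · rw [interior_Icc]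
      intro u hu
      rw [(hd u (ht0.trans hu.1)).deriv]
      have := hq u (ht0.trans hu.1) hu.2.le
      have hu0 : 0 < u := ht0.trans hu.1
      rw [neg_div]
      exact neg_nonpos.2 (by positivity)
  have := hanti (Set.left_mem_Icc.2 ht1) (Set.right_mem_Icc.2 ht1) ht1
  simp only [h1, zero_div] at this
  have hpos : 0 < t ^ N := by positivity
  simpa using (le_div_iff₀ hpos).1 this

/-- The derivation `α d/dα` on polynomials in `α`. -/
def euler : Derivation ℝ (Polynomial ℝ) (Polynomial ℝ) :=
  (Polynomial.X : Polynomial ℝ) • derivative'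

theorem euler_apply (p : Polynomial ℝ) : euler p = Polynomial.X * Polynomial.derivative p := rfl

theorem euler_X : euler Polynomial.X = Polynomial.X := by simp [euler_apply]

/-- The coefficients of `kernel`, as polynomials in the exponent. -/
def kernelCoeff (k l : ℕ) : Polynomial ℝ :=
  coeff l (coeff k (kernel (Polynomial.X : Polynomial ℝ)))

theorem euler_kernelCoeff (k l : ℕ) :
    Polynomial.X * Polynomial.derivative (kernelCoeff k l) =
      ((1 + k + l : ℕ) : Polynomial ℝ) * kernelCoeff k l -
        (coeff l (coeff k (divDiffTwo entropy)) +
          ∑ p ∈ antidiagonal l, coeff p.1 negLog * kernelCoeff k p.2 +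
          ∑ p ∈ antidiagonal k, coeff p.1 entropy * (kernelCoeff (p.2 + 1) l * (p.2 + 1)) +
          ∑ p ∈ antidiagonal l, coeff p.1 entropy * (kernelCoeff k (p.2 + 1) * (p.2 + 1))) := by
  have h := congrArg (fun F => coeff l (coeff k F)) (flowTwo_kernel euler_X Polynomial.X_ne_zero)
  simp only [coeff_flowTwo, map_sub, sub_mul, one_mul, coeff_inner_mul, coeff_mul l] at h
  simp only [kernelCoeff, euler_apply] at h ⊢
  push_cast
  linear_combination h

/-- Apply a ring homomorphism to all coefficients of a double series. -/
def mapTwo {R S : Type*} [CommRing R] [CommRing S] (φ : R →+* S) : R⟦X⟧⟦X⟧ →+* S⟦X⟧⟦X⟧ :=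
  PowerSeries.map (PowerSeries.map φ)

theorem mapTwo_inner {R S : Type*} [CommRing R] [CommRing S] (φ : R →+* S) (f : R⟦X⟧) :
    mapTwo φ (inner f) = inner (PowerSeries.map φ f) := by simp [mapTwo, inner]

theorem mapTwo_outer {R S : Type*} [CommRing R] [CommRing S] (φ : R →+* S) (f : R⟦X⟧) :
    mapTwo φ (outer f) = outer (PowerSeries.map φ f) := by
  ext k : 1
  simp [mapTwo, coeff_outer]

/-- The kernel at a real exponent. -/
def realKernel (t : ℝ) : ℝ⟦X⟧⟦X⟧ := mapTwo (Polynomial.evalRingHom t) (kernel Polynomial.X)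

theorem coeff_realKernel (t : ℝ) (k l : ℕ) :
    coeff l (coeff k (realKernel t)) = (kernelCoeff k l).eval t := rfl

theorem map_negBinomial (t : ℝ) :
    PowerSeries.map (Polynomial.evalRingHom t) (negBinomial (-Polynomial.X)) =
      negBinomial (-t) := by
  ext m
  simp only [negBinomial, coeff_map, coeff_mk, Polynomial.coe_evalRingHom, Polynomial.eval_prod,
    Polynomial.eval_smul, Polynomial.eval_add, Polynomial.eval_neg, Polynomial.eval_X,
    Polynomial.eval_natCast]

theorem realKernel_identity (t : ℝ) :
    inner (1 - X) * varDiff * (inner (negBinomial (-t)) - outer (negBinomial (-t))) *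
        realKernel t =
      inner (1 - X) * (inner (negBinomial (-t)) - outer (negBinomial (-t))) -
        inner (C t) * varDiff * inner (negBinomial (-t)) := by
  have h := congrArg (mapTwo (Polynomial.evalRingHom t))
    (kernel_identity (Polynomial.X_ne_zero (R := ℝ)))
  simpa only [realKernel, varDiff, map_mul, map_sub, mapTwo_inner, mapTwo_outer, map_negBinomial,
    map_one, PowerSeries.map_X, PowerSeries.map_C, Polynomial.coe_evalRingHom,
    Polynomial.eval_X] using h

theorem inner_one_sub_X_ne_zero : inner (1 - X : ℝ⟦X⟧) ≠ 0 := C_series_ne_zero one_sub_X_ne_zero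

theorem realKernel_one : realKernel 1 = 0 := by
  have h := realKernel_identity 1
  have hv : inner (1 - X : ℝ⟦X⟧) - outer (1 - X) = varDiff := by
    simp only [varDiff, map_sub, map_one]; ring
  rw [negBinomial_neg_one, hv, map_one, map_one] at h
  have h0 : inner (1 - X : ℝ⟦X⟧) * varDiff * varDiff ≠ 0 :=
    mul_ne_zero (mul_ne_zero inner_one_sub_X_ne_zero varDiff_ne_zero) varDiff_ne_zero
  apply mul_left_cancel₀ h0
  linear_combination h

theorem eval_coeff_entropy_nonneg (t : ℝ) (m : ℕ) :
    0 ≤ (coeff m (entropy : (Polynomial ℝ)⟦X⟧)).eval t := by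
  rw [entropy, coeff_mk, Polynomial.algebraMap_eq, Polynomial.eval_C, inv_nonneg]
  cases m with
  | zero => simp
  | succ m => push_cast; rw [add_sub_cancel_right]; positivity

theorem coeff_entropy_of_lt_two {m : ℕ} (hm : m < 2) :
    coeff m (entropy : (Polynomial ℝ)⟦X⟧) = 0 := by
  interval_cases m <;> simp [entropy, -coeff_zero_eq_constantCoeff]

theorem eval_kernelCoeff_nonneg (N : ℕ) : ∀ k l : ℕ, k + l = N → ∀ t : ℝ, 0 < t → t ≤ 1 →
    0 ≤ (kernelCoeff k l).eval t := by
  induction N using Nat.strong_induction_on with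
  | _ N ih =>
  intro k l hkl
  refine eval_nonneg_of_euler (euler_kernelCoeff k l) ?_ ?_
  · intro t ht0 ht1
    simp only [Polynomial.eval_add, Polynomial.eval_finsetSum, Polynomial.eval_mul]
    refine add_nonneg (add_nonneg (add_nonneg ?_ ?_) ?_) ?_
    · simp only [divDiffTwo, coeff_mk, Polynomial.eval_mul]
      refine mul_nonneg ?_ (eval_coeff_entropy_nonneg t _)
      simp only [Polynomial.eval_add, Polynomial.eval_natCast, Polynomial.eval_one]
      positivity
    · refine sum_nonneg fun p hp => ?_
      have hp := mem_antidiagonal.1 hp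
      rcases Nat.eq_zero_or_pos p.1 with h | h
      · simp [h, negLog, -coeff_zero_eq_constantCoeff]
      · refine mul_nonneg ?_ (ih (k + p.2) (by omega) _ _ rfl t ht0 ht1)
        simp [negLog]
    · refine sum_nonneg fun p hp => ?_
      have hp := mem_antidiagonal.1 hp
      rcases lt_or_ge p.1 2 with h | h
      · simp [coeff_entropy_of_lt_two h]
      · refine mul_nonneg (eval_coeff_entropy_nonneg t _)
          (mul_nonneg (ih (p.2 + 1 + l) (by omega) _ _ rfl t ht0 ht1) ?_)
        simp only [Polynomial.eval_natCast, Polynomial.eval_one]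
        positivity
    · refine sum_nonneg fun p hp => ?_
      have hp := mem_antidiagonal.1 hp
      rcases lt_or_ge p.1 2 with h | h
      · simp [coeff_entropy_of_lt_two h]
      · refine mul_nonneg (eval_coeff_entropy_nonneg t _)
          (mul_nonneg (ih (k + (p.2 + 1)) (by omega) _ _ rfl t ht0 ht1) ?_)
        simp only [Polynomial.eval_natCast, Polynomial.eval_one]
        positivity
  · rw [← coeff_realKernel, realKernel_one]
    simp

theorem coeff_realKernel_nonneg {t : ℝ} (ht0 : 0 < t) (ht1 : t ≤ 1) (k l : ℕ) :
    0 ≤ coeff l (coeff k (realKernel t)) :=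
  eval_kernelCoeff_nonneg _ k l rfl t ht0 ht1

end Positivity

section Discrete

/-- Exchange the two variables of a double series. -/
def swapVars (F : ℝ⟦X⟧⟦X⟧) : ℝ⟦X⟧⟦X⟧ :=
  PowerSeries.mk fun k => PowerSeries.mk fun l => coeff k (coeff l F)

theorem coeff_swapVars (F : ℝ⟦X⟧⟦X⟧) (k l : ℕ) :
    coeff l (coeff k (swapVars F)) = coeff k (coeff l F) := by simp [swapVars]

theorem swapVars_mul (F G : ℝ⟦X⟧⟦X⟧) : swapVars (F * G) = swapVars F * swapVars G := by
  ext k l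
  rw [coeff_swapVars, coeff_mul, coeff_mul, map_sum, map_sum]
  simp only [coeff_mul, coeff_swapVars]
  exact sum_comm

theorem swapVars_sub (F G : ℝ⟦X⟧⟦X⟧) : swapVars (F - G) = swapVars F - swapVars G := by
  ext k l
  simp [coeff_swapVars]

theorem swapVars_outer (f : ℝ⟦X⟧) : swapVars (outer f) = inner f := by
  ext k l
  rw [coeff_swapVars, coeff_outer, inner, coeff_C, coeff_C]
  split_ifs <;> simp

theorem swapVars_inner (f : ℝ⟦X⟧) : swapVars (inner f) = outer f := by
  rw [← swapVars_outer]
  ext k l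
  simp [coeff_swapVars]

theorem coeff_negBinomial_nonneg {r : ℝ} (hr : 0 ≤ r) (m : ℕ) : 0 ≤ coeff m (negBinomial r) := by
  rw [negBinomial, coeff_mk]
  exact prod_nonneg fun i _ => by rw [smul_eq_mul]; positivity

theorem negBinomial_nat_mul_add_one (n : ℕ) (r : ℝ) :
    negBinomial (n * r + 1) = negBinomial r ^ n * negBinomial 1 := by
  rw [negBinomial_add, negBinomial_nat_mul]

theorem outer_sub_inner_negBinomial_ne_zero {t : ℝ} (ht : t ≠ 0) :
    outer (negBinomial t) - inner (negBinomial t) ≠ 0 := by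
  intro h
  have := congrArg (fun F => coeff 0 (coeff 1 F)) h
  simp [coeff_outer, inner, negBinomial, coeff_C, ht] at this

theorem varDiff_mul_sub_mul_realKernel (t : ℝ) :
    varDiff * (outer (negBinomial t) - inner (negBinomial t)) * realKernel t =
      outer (negBinomial t) - inner (negBinomial t) -
        inner (C t) * varDiff * outer (negBinomial t) * inner (negBinomial 1) := by
  have h := realKernel_identity t
  have he : negBinomial (-t) * negBinomial t = 1 := by
    rw [← negBinomial_add, neg_add_cancel, negBinomial_zero]
  have hh : (1 - X) * negBinomial (1 : ℝ) = 1 := by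
    rw [← negBinomial_neg_one, ← negBinomial_add, neg_add_cancel, negBinomial_zero]
  have hex := congrArg outer he
  have hey := congrArg inner he
  have hhy := congrArg inner hh
  rw [map_mul, map_one] at hex hey hhy
  apply mul_left_cancel₀ inner_one_sub_X_ne_zero
  generalize inner (1 - X : ℝ⟦X⟧) = q at *
  generalize outer (negBinomial t) = x at *
  generalize inner (negBinomial t) = y at *
  generalize outer (negBinomial (-t)) = u at *
  generalize inner (negBinomial (-t)) = v at *
  generalize inner (negBinomial (1 : ℝ)) = w at *
  generalize realKernel t = K at *
  generalize inner (C t) = c at *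
  linear_combination x * y * h - q * varDiff * K * (x * hey - y * hex) +
    q * (x * hey - y * hex) - c * varDiff * x * hey + c * varDiff * x * hhy

theorem divDiff_sub_eq {t : ℝ} (ht : t ≠ 0) (n : ℕ) :
    divDiff (negBinomial (n * t + 1)) - inner (C t) * ∑ j ∈ range (n + 1),
        outer (negBinomial (j * t + 1)) * inner (negBinomial (((n - j : ℕ) : ℝ) * t + 1)) =
      outer (negBinomial (n * t + 1)) * realKernel t +
        inner (negBinomial (n * t + 1)) * swapVars (realKernel t) := by
  have h1 := varDiff_mul_sub_mul_realKernel t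
  have h2 := congrArg swapVars h1
  have hv : swapVars (varDiff : ℝ⟦X⟧⟦X⟧) = -varDiff := by
    rw [varDiff, swapVars_sub, swapVars_inner, swapVars_outer]; ring
  simp only [swapVars_mul, swapVars_sub, hv, swapVars_inner, swapVars_outer, outer_C] at h2
  have h3 : varDiff * divDiff (negBinomial (n * t + 1)) = _ := varDiff_mul_divDiff _
  have h4 := geom_sum₂_mul (outer (negBinomial t)) (inner (negBinomial t)) (n + 1)
  simp only [negBinomial_nat_mul_add_one, map_mul, map_pow] at h3 ⊢
  have h5 : ∑ j ∈ range (n + 1), outer (negBinomial t) ^ j * outer (negBinomial 1) *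
        (inner (negBinomial t) ^ (n - j) * inner (negBinomial 1)) =
      outer (negBinomial 1) * inner (negBinomial 1) * ∑ j ∈ range (n + 1),
        outer (negBinomial t) ^ j * inner (negBinomial t) ^ (n + 1 - 1 - j) := by
    rw [mul_sum]
    refine sum_congr rfl fun j _ => ?_
    rw [Nat.add_sub_cancel]
    ring
  rw [h5]
  apply mul_left_cancel₀ (mul_ne_zero varDiff_ne_zero (outer_sub_inner_negBinomial_ne_zero ht))
  generalize (∑ j ∈ range (n + 1),
        outer (negBinomial t) ^ j * inner (negBinomial t) ^ (n + 1 - 1 - j)) = S at *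
  generalize divDiff (negBinomial t ^ n * negBinomial 1) = d at *
  generalize outer (negBinomial t) = x at *
  generalize inner (negBinomial t) = y at *
  generalize outer (negBinomial (1 : ℝ)) = v at *
  generalize inner (negBinomial (1 : ℝ)) = w at *
  generalize realKernel t = K at *
  generalize swapVars K = K' at *
  generalize inner (C t) = c at *
  linear_combination (x - y) * h3 - c * varDiff * v * w * h4 - x ^ n * v * h1 - y ^ n * w * h2

/-- The neo-classical inequality for the coefficients of `(1 - X) ^ (-(j * t + 1))`. -/
theorem discrete_neo_classical {t : ℝ} (ht0 : 0 < t) (ht1 : t ≤ 1) (n k l : ℕ) :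
    t * ∑ j ∈ range (n + 1), coeff k (negBinomial (j * t + 1)) *
        coeff l (negBinomial (((n - j : ℕ) : ℝ) * t + 1)) ≤
      coeff (k + l + 1) (negBinomial (n * t + 1)) := by
  have h := congrArg (fun F => coeff l (coeff k F)) (divDiff_sub_eq ht0.ne' n)
  have hK := coeff_realKernel_nonneg ht0 ht1
  have hn : ∀ m, 0 ≤ coeff m (negBinomial (n * t + 1)) := coeff_negBinomial_nonneg (by positivity)
  have hd : coeff l (coeff k (divDiff (negBinomial (n * t + 1)))) =
    coeff (k + l + 1) (negBinomial (n * t + 1)) := by simp [divDiff]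
  have hS : coeff l (coeff k (inner (C t) * ∑ j ∈ range (n + 1), outer (negBinomial (j * t + 1)) *
      inner (negBinomial (((n - j : ℕ) : ℝ) * t + 1)))) =
      t * ∑ j ∈ range (n + 1), coeff k (negBinomial (j * t + 1)) *
        coeff l (negBinomial (((n - j : ℕ) : ℝ) * t + 1)) := by
    rw [coeff_inner_mul, coeff_C_mul, map_sum, map_sum]
    simp only [coeff_outer_mul_inner]
  simp only [map_sub, map_add] at h
  rw [hd, hS, coeff_coeff_outer_mul, coeff_inner_mul, coeff_mul] at h
  rw [← sub_nonneg, h]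
  refine add_nonneg (sum_nonneg fun p _ => mul_nonneg (hn _) (hK _ _))
    (sum_nonneg fun p _ => mul_nonneg (hn _) ?_)
  rw [coeff_swapVars]
  exact hK _ _

end Discrete

section Limit

theorem tendsto_coeff_negBinomial {r : ℝ} (hr : 0 ≤ r) :
    Tendsto (fun m : ℕ => coeff m (negBinomial (r + 1)) / (m : ℝ) ^ r) atTop
      (𝓝 (Real.Gamma (1 + r))⁻¹) := by
  have hΓ := Real.GammaSeq_tendsto_Gamma (r + 1)
  have h1 : Tendsto (fun m : ℕ => (m : ℝ) / (m + (r + 1))) atTop (𝓝 1) :=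
    tendsto_natCast_div_add_atTop (r + 1)
  have h2 := h1.mul (hΓ.inv₀ (Real.Gamma_pos_of_pos (by positivity)).ne')
  rw [one_mul, add_comm r 1] at h2
  refine h2.congr' ?_
  filter_upwards [eventually_gt_atTop 0] with m hm
  have hm' : (0 : ℝ) < m := by exact_mod_cast hm
  have hp : coeff m (negBinomial (r + 1)) * m.factorial = ∏ i ∈ range m, (r + 1 + i) := by
    rw [negBinomial, coeff_mk, ← prod_range_add_one_eq_factorial]
    push_cast
    rw [← prod_mul_distrib]
    refine prod_congr rfl fun i _ => ?_
    rw [smul_eq_mul]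
    field_simp
  have hf : (0 : ℝ) < m.factorial := by exact_mod_cast m.factorial_pos
  have hP : 0 < ∏ i ∈ range m, (r + 1 + i) := prod_pos fun i _ => by positivity
  rw [add_comm 1 r, Real.GammaSeq, prod_range_succ, ← hp, Real.rpow_add_one hm'.ne']
  have hr' : (0 : ℝ) < (m : ℝ) ^ r := by positivity
  have : (0 : ℝ) < m + (r + 1) := by positivity
  field_simp
  ring

theorem tendsto_coeff_negBinomial_comp {r c : ℝ} (hr : 0 ≤ r) (hc : 0 < c) {u : ℕ → ℕ}
    (hu : Tendsto (fun m => (u m : ℝ) / m) atTop (𝓝 c)) :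
    Tendsto (fun m : ℕ => coeff (u m) (negBinomial (r + 1)) / (m : ℝ) ^ r) atTop
      (𝓝 (c ^ r / Real.Gamma (1 + r))) := by
  have hu' : Tendsto u atTop atTop := by
    rw [← tendsto_natCast_atTop_iff (R := ℝ)]
    refine (hu.pos_mul_atTop hc tendsto_natCast_atTop_atTop).congr' ?_
    filter_upwards [eventually_gt_atTop 0] with m hm
    have hm' : (m : ℝ) ≠ 0 := by exact_mod_cast hm.ne'
    field_simp
  have h1 := (hu.rpow_const (p := r) (Or.inl hc.ne')).mul
    ((tendsto_coeff_negBinomial hr).comp hu')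
  rw [← div_eq_mul_inv] at h1
  refine h1.congr' ?_
  filter_upwards [eventually_gt_atTop 0, hu'.eventually_gt_atTop 0] with m hm hum
  have hm' : (0 : ℝ) < m := by exact_mod_cast hm
  have hum' : (0 : ℝ) < u m := by exact_mod_cast hum
  rw [Function.comp_apply, Real.div_rpow hum'.le hm'.le]
  have := Real.rpow_pos_of_pos hum' r
  field_simp

end Limit

end NeoClassical

end

open NeoClassical

/-- Neo-classical inequality: for `α ∈ (0,1]`, `n ∈ ℕ`, `s, t > 0`,
`α ∑_{j=0}^n s^{jα} t^{(n-j)α} / (Γ(1+jα) Γ(1+(n-j)α)) ≤ (s+t)^{nα} / Γ(1+nα)`. -/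
theorem neo_classical_inequality
    (α : ℝ) (hα0 : 0 < α) (hα1 : α ≤ 1) (n : ℕ) (s t : ℝ) (hs : 0 < s) (ht : 0 < t) :
    α * ∑ j ∈ Finset.range (n + 1),
        s ^ ((j : ℝ) * α) * t ^ (((n : ℝ) - j) * α) /
          (Real.Gamma (1 + j * α) * Real.Gamma (1 + ((n : ℝ) - j) * α))
      ≤ (s + t) ^ ((n : ℝ) * α) / Real.Gamma (1 + n * α) := by
  have hfloor : ∀ c : ℝ, 0 < c → Tendsto (fun m : ℕ => (⌊c * m⌋₊ : ℝ) / m) atTop (𝓝 c) :=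
    fun c hc => (tendsto_nat_floor_mul_div_atTop hc.le).comp tendsto_natCast_atTop_atTop
  have hsum : Tendsto (fun m : ℕ => ((⌊s * m⌋₊ + ⌊t * m⌋₊ + 1 : ℕ) : ℝ) / m) atTop
      (𝓝 (s + t)) := by
    have h := ((hfloor s hs).add (hfloor t ht)).add (tendsto_one_div_atTop_nhds_zero_nat (𝕜 := ℝ))
    rw [add_zero] at h
    refine h.congr fun m => ?_
    push_cast
    ring
  have hR := tendsto_coeff_negBinomial_comp (r := n * α) (by positivity) (add_pos hs ht) hsum
  have hL : Tendsto (fun m : ℕ => α * ∑ j ∈ range (n + 1),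
      coeff ⌊s * m⌋₊ (negBinomial (j * α + 1)) / (m : ℝ) ^ ((j : ℝ) * α) *
        (coeff ⌊t * m⌋₊ (negBinomial (((n - j : ℕ) : ℝ) * α + 1)) /
          (m : ℝ) ^ (((n - j : ℕ) : ℝ) * α))) atTop
      (𝓝 (α * ∑ j ∈ range (n + 1), s ^ ((j : ℝ) * α) / Real.Gamma (1 + j * α) *
        (t ^ (((n - j : ℕ) : ℝ) * α) / Real.Gamma (1 + ((n - j : ℕ) : ℝ) * α)))) :=
    (tendsto_finsetSum _ fun j _ =>
      (tendsto_coeff_negBinomial_comp (by positivity) hs (hfloor s hs)).mul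
        (tendsto_coeff_negBinomial_comp (by positivity) ht (hfloor t ht))).const_mul α
  have hcast : ∀ j ∈ range (n + 1), ((n - j : ℕ) : ℝ) = n - j := fun j hj =>
    Nat.cast_sub (Nat.lt_succ_iff.1 (mem_range.1 hj))
  have hlim := le_of_tendsto_of_tendsto hL hR ?_
  · refine le_trans (le_of_eq ?_) hlim
    congr 1
    refine sum_congr rfl fun j hj => ?_
    rw [hcast j hj, div_mul_div_comm]
  · filter_upwards [eventually_gt_atTop 0] with m hm
    have hm' : (0 : ℝ) < m := by exact_mod_cast hm
    have h := div_le_div_of_nonneg_right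
      (discrete_neo_classical hα0 hα1 n ⌊s * m⌋₊ ⌊t * m⌋₊)
      (Real.rpow_pos_of_pos hm' (n * α)).le
    refine le_trans (le_of_eq ?_) h
    rw [mul_div_assoc, sum_div]
    congr 1
    refine sum_congr rfl fun j hj => ?_
    rw [div_mul_div_comm, ← Real.rpow_add hm', ← add_mul, hcast j hj, add_sub_cancel]
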